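/- For any UCQ 𝒬 and finite set ℛ of disjunctive existential rules, the set W(𝒬, ℛ) = ⋃_{i ∈ ℕ} W_i(𝒬, ℛ) is a sound and complete rewriting of (𝒬, ℛ): for every fact base F, F ⊨ W(𝒬, ℛ) (i.e., F entails some CQ in it) if and only if F, ℛ ⊨ 𝒬. -/

import Mathlib

/-! ## Basic syntax: terms, atoms, substitutions -/

/-- A term over variables `V` and constants `C`. -/
inductive FOTerm (V C : Type) where
  | var (v : V)
  | const (c : C)
deriving DecidableEq

/-- An atom `p(t_1,...,t_n)`. -/
structure FOAtom (P V C : Type) where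
  pred : P
  args : List (FOTerm V C)
deriving DecidableEq

/-- A substitution of variables by terms. -/
abbrev FOSubst (V C : Type) := V → FOTerm V C

variable {P V C : Type}

def FOTerm.applySub (u : FOSubst V C) : FOTerm V C → FOTerm V C
  | FOTerm.var v => u v
  | FOTerm.const c => FOTerm.const c

def FOAtom.applySub (u : FOSubst V C) (a : FOAtom P V C) : FOAtom P V C :=
  ⟨a.pred, a.args.map (FOTerm.applySub u)⟩

def applySubFS [DecidableEq P] [DecidableEq V] [DecidableEq C]
    (u : FOSubst V C) (S : Finset (FOAtom P V C)) : Finset (FOAtom P V C) :=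
  S.image (FOAtom.applySub u)

def FOTerm.varsOf [DecidableEq V] : FOTerm V C → Finset V
  | FOTerm.var v => {v}
  | FOTerm.const _ => ∅

def FOAtom.varsOf [DecidableEq V] (a : FOAtom P V C) : Finset V :=
  a.args.foldr (fun t acc => t.varsOf ∪ acc) ∅

/-- Variables occurring in a finite set of atoms. -/
def varsFS [DecidableEq V] (S : Finset (FOAtom P V C)) : Finset V :=
  S.sup FOAtom.varsOf

/-- Terms occurring in a finite set of atoms. -/
def termsFS [DecidableEq V] [DecidableEq C] (S : Finset (FOAtom P V C)) :
    Finset (FOTerm V C) :=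
  S.sup (fun a => a.args.toFinset)

/-- `h` is a homomorphism from the atom set `S₁` to the atom set `S₂`. -/
def IsHom (h : FOSubst V C) (S₁ S₂ : Finset (FOAtom P V C)) : Prop :=
  ∀ a ∈ S₁, a.applySub h ∈ S₂

/-- `S₂ ⊨ S₁` for atom sets viewed as existentially closed conjunctions:
there is a homomorphism from `S₁` to `S₂`. -/
def EntailsFS (S₂ S₁ : Finset (FOAtom P V C)) : Prop :=
  ∃ h : FOSubst V C, IsHom h S₁ S₂

/-! ## Disjunctive existential rules, triggers, chase step α -/

/-- A disjunctive existential rule `B → H₁ ∨ ... ∨ Hₙ`. -/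
structure DisjRule (P V C : Type) where
  body : Finset (FOAtom P V C)
  heads : List (Finset (FOAtom P V C))

/-- Well-formedness: non-empty body, at least one head disjunct, non-empty disjuncts. -/
def DisjRule.WF (R : DisjRule P V C) : Prop :=
  R.body.Nonempty ∧ R.heads ≠ [] ∧ ∀ H ∈ R.heads, H.Nonempty

/-- All variables of a rule. -/
def DisjRule.vars [DecidableEq V] (R : DisjRule P V C) : Finset V :=
  varsFS R.body ∪ R.heads.foldr (fun H acc => varsFS H ∪ acc) ∅

/-- A trigger `(R, h)` on `F`: `h` is a homomorphism from the body of `R` to `F`. -/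
def IsTrigger (R : DisjRule P V C) (h : FOSubst V C) (F : Finset (FOAtom P V C)) : Prop :=
  IsHom h R.body F

/-- `h'` is a safe extension of `h` for the head disjunct `H` of rule `R` w.r.t. the
fact base `F`: it agrees with `h` outside the existential variables of `H` and renames
the existential variables of `H` injectively to fresh variables. -/
def IsSafeExt [DecidableEq V] (F : Finset (FOAtom P V C)) (R : DisjRule P V C)
    (H : Finset (FOAtom P V C)) (h h' : FOSubst V C) : Prop :=
  (∀ v : V, v ∉ varsFS H \ varsFS R.body → h' v = h v) ∧
  (∀ v ∈ varsFS H \ varsFS R.body, ∃ w : V, h' v = FOTerm.var w ∧ w ∉ varsFS F) ∧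
  (∀ v ∈ varsFS H \ varsFS R.body, ∀ v' ∈ varsFS H \ varsFS R.body,
      h' v = h' v' → v = v')

/-- `L` is a result of the application `α_∨(F, R, h)` of the trigger `(R, h)` on `F`:
its `i`-th element is `F ∪ h^{safeᵢ}(Hᵢ)`. -/
def IsAlpha [DecidableEq P] [DecidableEq V] [DecidableEq C]
    (F : Finset (FOAtom P V C)) (R : DisjRule P V C) (h : FOSubst V C)
    (L : List (Finset (FOAtom P V C))) : Prop :=
  L.length = R.heads.length ∧
  ∀ (i : ℕ) (hi : i < L.length) (hi' : i < R.heads.length),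
    ∃ h' : FOSubst V C, IsSafeExt F R (R.heads.get ⟨i, hi'⟩) h h' ∧
      L.get ⟨i, hi⟩ = F ∪ applySubFS h' (R.heads.get ⟨i, hi'⟩)

/-! ## Partitions of terms (as equivalence relations), piece-unifiers -/

/-- A relation on terms, representing a partition of a set of terms (two terms are
related iff they belong to the same class). -/
abbrev TRel (V C : Type) := FOTerm V C → FOTerm V C → Prop

/-- Admissibility of a partition: no class contains two distinct constants. -/
def RelAdmissible (r : TRel V C) : Prop :=
  ∀ c c' : C, r (FOTerm.const c) (FOTerm.const c') → c = c'

/-- `u` is a substitution associated with the partition represented by `r`: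
it is constant on classes, maps each term to a member of its class (the selected term),
and gives priority to constants. -/
def IsAssocSub (r : TRel V C) (u : FOSubst V C) : Prop :=
  (∀ s t, r s t → s.applySub u = t.applySub u) ∧
  (∀ t, r t (t.applySub u)) ∧
  (∀ (v : V) (c : C), r (FOTerm.var v) (FOTerm.const c) → u v = FOTerm.const c)

/-- The data of a piece-unifier `(Q', H', P_u)`. -/
structure PieceUnif (P V C : Type) where
  Q' : Finset (FOAtom P V C)
  H' : Finset (FOAtom P V C)
  rel : TRel V C

/-- `μ` is a piece-unifier of the CQ `Q` with the conjunctive rule `B → H`. -/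
def IsPieceUnifier [DecidableEq P] [DecidableEq V] [DecidableEq C]
    (Q : Finset (FOAtom P V C)) (B H : Finset (FOAtom P V C))
    (μ : PieceUnif P V C) : Prop :=
  μ.Q'.Nonempty ∧ μ.Q' ⊆ Q ∧ μ.H' ⊆ H ∧
  Equivalence μ.rel ∧
  -- the partition is on the terms of Q' and H' (all other classes are singletons)
  (∀ s t, μ.rel s t → s = t ∨
      (s ∈ termsFS μ.Q' ∪ termsFS μ.H' ∧ t ∈ termsFS μ.Q' ∪ termsFS μ.H')) ∧
  RelAdmissible μ.rel ∧
  -- classes containing an existential variable of H' contain otherwise only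
  -- non-separating variables of Q'
  (∀ z ∈ varsFS μ.H' \ varsFS B, ∀ t, μ.rel (FOTerm.var z) t → t = FOTerm.var z ∨
      ∃ v : V, t = FOTerm.var v ∧ FOTerm.var v ∈ termsFS μ.Q' ∧ v ∉ varsFS (Q \ μ.Q')) ∧
  -- unification condition
  (∀ u : FOSubst V C, IsAssocSub μ.rel u → applySubFS u μ.Q' = applySubFS u μ.H')

/-- The join of a list of partitions (represented as relations): the equivalence
relation generated by their union. -/
def joinRel (rs : List (TRel V C)) : TRel V C :=
  Relation.EqvGen (fun s t => ∃ r ∈ rs, r s t)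

/-- The data of a disjunctive piece-unifier: the safe copies `Q₁, ..., Qₙ` together
with the conjunctive piece-unifiers `μ₁, ..., μₙ`. -/
structure DisjPieceUnif (P V C : Type) where
  Qs : List (Finset (FOAtom P V C))
  mus : List (PieceUnif P V C)

/-- The join of the partitions of a disjunctive piece-unifier. -/
def DisjPieceUnif.rel (μ : DisjPieceUnif P V C) : TRel V C :=
  joinRel (μ.mus.map PieceUnif.rel)

/-- `Qc` is a safe copy of `Q` (bijective renaming of its variables). -/
def IsSafeCopy [DecidableEq P] [DecidableEq V] [DecidableEq C]
    (Q Qc : Finset (FOAtom P V C)) : Prop :=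
  ∃ ρ : V → V, Function.Injective ρ ∧
    Qc = Q.image (FOAtom.applySub (fun v => FOTerm.var (ρ v)))

/-- `μ` is a disjunctive piece-unifier of the UCQ `𝒬` with the disjunctive rule `R`. -/
def IsDisjPieceUnifier [DecidableEq P] [DecidableEq V] [DecidableEq C]
    (𝒬 : Set (Finset (FOAtom P V C))) (R : DisjRule P V C)
    (μ : DisjPieceUnif P V C) : Prop :=
  μ.Qs.length = R.heads.length ∧ μ.mus.length = R.heads.length ∧
  -- each Qᵢ is a safe copy of a CQ of 𝒬, with variables disjoint from the rule
  -- and from the other copies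
  (∀ (i : ℕ) (hi : i < μ.Qs.length), ∃ Q ∈ 𝒬, IsSafeCopy Q (μ.Qs.get ⟨i, hi⟩)) ∧
  (∀ (i : ℕ) (hi : i < μ.Qs.length), Disjoint (varsFS (μ.Qs.get ⟨i, hi⟩)) R.vars) ∧
  (∀ (i j : ℕ) (hi : i < μ.Qs.length) (hj : j < μ.Qs.length), i ≠ j →
      Disjoint (varsFS (μ.Qs.get ⟨i, hi⟩)) (varsFS (μ.Qs.get ⟨j, hj⟩))) ∧
  -- each μᵢ is a piece-unifier of Qᵢ with B → Hᵢ
  (∀ (i : ℕ) (hi : i < R.heads.length) (hi1 : i < μ.Qs.length) (hi2 : i < μ.mus.length),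
      IsPieceUnifier (μ.Qs.get ⟨i, hi1⟩) R.body (R.heads.get ⟨i, hi⟩)
        (μ.mus.get ⟨i, hi2⟩)) ∧
  -- the join of the partitions is admissible
  RelAdmissible μ.rel

/-- `β_∨(𝒬, R, μ) = u(B) ∪ ⋃ᵢ u(Qᵢ ∖ Qᵢ')`, for `u` a substitution associated with
the join of the partitions of `μ`. -/
def betaRw [DecidableEq P] [DecidableEq V] [DecidableEq C]
    (R : DisjRule P V C) (μ : DisjPieceUnif P V C) (u : FOSubst V C) :
    Finset (FOAtom P V C) :=
  applySubFS u R.body ∪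
    (List.zipWith (fun Qi m => applySubFS u (Qi \ PieceUnif.Q' m)) μ.Qs μ.mus).foldr
      (· ∪ ·) ∅

/-! ## Semantics -/

/-- A first-order interpretation (with non-empty domain). -/
structure Interp (P V C : Type) where
  dom : Type
  nonempty : Nonempty dom
  rel : P → List dom → Prop
  cst : C → dom

def Interp.evalT (I : Interp P V C) (a : V → I.dom) : FOTerm V C → I.dom
  | FOTerm.var v => a v
  | FOTerm.const c => I.cst c

def Interp.satAtom (I : Interp P V C) (a : V → I.dom) (atm : FOAtom P V C) : Prop :=
  I.rel atm.pred (atm.args.map (I.evalT a))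

def Interp.satFS (I : Interp P V C) (a : V → I.dom) (S : Finset (FOAtom P V C)) : Prop :=
  ∀ atm ∈ S, I.satAtom a atm

/-- `I` is a model of the atom set `S` viewed as an existentially closed conjunction. -/
def Interp.modelsFB [DecidableEq V] (I : Interp P V C) (S : Finset (FOAtom P V C)) : Prop :=
  ∃ a : V → I.dom, I.satFS a S

/-- `I` satisfies the disjunctive existential rule `R`. -/
def Interp.satRule [DecidableEq V] (I : Interp P V C) (R : DisjRule P V C) : Prop :=
  ∀ a : V → I.dom, I.satFS a R.body →
    ∃ H ∈ R.heads, ∃ a' : V → I.dom,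
      (∀ v ∈ varsFS R.body, a' v = a v) ∧ I.satFS a' H

/-- First-order entailment `F, ℛ ⊨ 𝒬` of a UCQ from a fact base and a set of
disjunctive existential rules. -/
def SemEntails [DecidableEq V] (F : Finset (FOAtom P V C)) (ℛ : Set (DisjRule P V C))
    (𝒬 : Set (Finset (FOAtom P V C))) : Prop :=
  ∀ I : Interp P V C, I.modelsFB F → (∀ R ∈ ℛ, I.satRule R) →
    ∃ Q ∈ 𝒬, I.modelsFB Q

/-! ## Piece-rewriting -/

/-- `IsPieceRewriting ℛ 𝒬 𝒬'` holds when the UCQ `𝒬'` is obtained from the UCQ `𝒬`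
by a finite sequence of one-step piece-rewritings with rules of `ℛ`. -/
inductive IsPieceRewriting [DecidableEq P] [DecidableEq V] [DecidableEq C]
    (ℛ : Set (DisjRule P V C)) :
    Finset (Finset (FOAtom P V C)) → Finset (Finset (FOAtom P V C)) → Prop
  | refl (𝒬 : Finset (Finset (FOAtom P V C))) : IsPieceRewriting ℛ 𝒬 𝒬
  | step (𝒬 𝒬' : Finset (Finset (FOAtom P V C))) (R : DisjRule P V C)
      (μ : DisjPieceUnif P V C) (u : FOSubst V C) :
      IsPieceRewriting ℛ 𝒬 𝒬' → R ∈ ℛ →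
      IsDisjPieceUnifier (↑𝒬' : Set (Finset (FOAtom P V C))) R μ →
      IsAssocSub μ.rel u →
      IsPieceRewriting ℛ 𝒬 (insert (betaRw R μ u) 𝒬')

/-- The breadth-first rewriting operator `W`: `W_0(𝒬, ℛ) = 𝒬` and `W_{i+1}(𝒬, ℛ)`
adds all the CQs `β_∨(W_i(𝒬, ℛ), R, μ_∨)` for disjunctive piece-unifiers `μ_∨` of
`W_i(𝒬, ℛ)` with rules `R ∈ ℛ`. -/
def Wop {P V C : Type} [DecidableEq P] [DecidableEq V] [DecidableEq C]
    (𝒬 : Finset (Finset (FOAtom P V C))) (ℛ : Set (DisjRule P V C)) :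
    ℕ → Set (Finset (FOAtom P V C))
  | 0 => ↑𝒬
  | (i + 1) =>
      Wop 𝒬 ℛ i ∪
        { q | ∃ R ∈ ℛ, ∃ (μ : DisjPieceUnif P V C) (u : FOSubst V C),
            IsDisjPieceUnifier (Wop 𝒬 ℛ i) R μ ∧ IsAssocSub μ.rel u ∧
            q = betaRw R μ u }

/-! ## Basic lemmas on terms, atoms and substitutions -/

theorem FOTerm.mem_varsOf [DecidableEq V] {v : V} {t : FOTerm V C} :
    v ∈ t.varsOf ↔ t = FOTerm.var v := by
  cases t <;> simp [FOTerm.varsOf, eq_comm]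

theorem FOAtom.mem_varsOf [DecidableEq V] {v : V} {a : FOAtom P V C} :
    v ∈ a.varsOf ↔ FOTerm.var v ∈ a.args := by
  obtain ⟨p, l⟩ := a
  induction l with
  | nil => simp [FOAtom.varsOf]
  | cons t l ih =>
    simp only [FOAtom.varsOf] at ih
    simp [FOAtom.varsOf, ih, FOTerm.mem_varsOf, eq_comm]

theorem mem_varsFS [DecidableEq V] {v : V} {S : Finset (FOAtom P V C)} :
    v ∈ varsFS S ↔ ∃ a ∈ S, FOTerm.var v ∈ a.args := by
  simp [varsFS, Finset.mem_sup, FOAtom.mem_varsOf]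

theorem mem_termsFS [DecidableEq V] [DecidableEq C] {t : FOTerm V C}
    {S : Finset (FOAtom P V C)} : t ∈ termsFS S ↔ ∃ a ∈ S, t ∈ a.args := by
  simp [termsFS, Finset.mem_sup]

theorem var_mem_termsFS [DecidableEq V] [DecidableEq C] {v : V}
    {S : Finset (FOAtom P V C)} : FOTerm.var v ∈ termsFS S ↔ v ∈ varsFS S := by
  rw [mem_termsFS, mem_varsFS]

theorem varsFS_mono [DecidableEq V] {S T : Finset (FOAtom P V C)} (h : S ⊆ T) :
    varsFS S ⊆ varsFS T :=
  Finset.sup_mono h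

theorem DisjRule.mem_vars [DecidableEq V] {R : DisjRule P V C} {v : V} :
    v ∈ R.vars ↔ v ∈ varsFS R.body ∨ ∃ H ∈ R.heads, v ∈ varsFS H := by
  have foldr_iff (l : List (Finset (FOAtom P V C))) :
      v ∈ l.foldr (fun H acc => varsFS H ∪ acc) ∅ ↔ ∃ H ∈ l, v ∈ varsFS H := by
    induction l with
    | nil => simp
    | cons H l ih => simp [ih]
  rw [DisjRule.vars, Finset.mem_union, foldr_iff]

theorem mem_foldr_union {α : Type*} [DecidableEq α] {x : α} {l : List (Finset α)} :
    x ∈ l.foldr (· ∪ ·) ∅ ↔ ∃ s ∈ l, x ∈ s := by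
  induction l with
  | nil => simp
  | cons s l ih => simp [ih]

theorem mem_betaRw [DecidableEq P] [DecidableEq V] [DecidableEq C]
    {R : DisjRule P V C} {μ : DisjPieceUnif P V C} {u : FOSubst V C} {b : FOAtom P V C} :
    b ∈ betaRw R μ u ↔ (∃ a ∈ R.body, a.applySub u = b) ∨
      ∃ (i : ℕ) (h₁ : i < μ.Qs.length) (h₂ : i < μ.mus.length),
        ∃ q ∈ μ.Qs.get ⟨i, h₁⟩ \ (μ.mus.get ⟨i, h₂⟩).Q', q.applySub u = b := by
  rw [betaRw, Finset.mem_union, mem_foldr_union]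
  refine or_congr (by simp [applySubFS]) ?_
  constructor
  · rintro ⟨s, hs, hb⟩
    obtain ⟨i, hi, rfl⟩ := List.mem_iff_getElem.mp hs
    have hi' := hi
    rw [List.length_zipWith, lt_min_iff] at hi'
    refine ⟨i, hi'.1, hi'.2, ?_⟩
    rw [List.getElem_zipWith] at hb
    exact Finset.mem_image.mp hb
  · rintro ⟨i, h₁, h₂, q, hq, rfl⟩
    refine ⟨_, List.mem_iff_getElem.mpr ⟨i, by simp [h₁, h₂], rfl⟩, ?_⟩
    rw [List.getElem_zipWith]
    exact Finset.mem_image_of_mem _ hq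

theorem FOTerm.applySub_applySub (u w : FOSubst V C) (t : FOTerm V C) :
    (t.applySub u).applySub w = t.applySub (fun v => (u v).applySub w) := by
  cases t <;> rfl

theorem FOAtom.applySub_applySub (u w : FOSubst V C) (a : FOAtom P V C) :
    (a.applySub u).applySub w = a.applySub (fun v => (u v).applySub w) := by
  simp [FOAtom.applySub, FOTerm.applySub_applySub]

theorem FOTerm.applySub_congr {u w : FOSubst V C} {t : FOTerm V C}
    (h : ∀ v, t = FOTerm.var v → u v = w v) : t.applySub u = t.applySub w := by
  cases t with
  | var v => exact h v rfl
  | const c => rfl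

theorem FOAtom.applySub_congr {u w : FOSubst V C} {a : FOAtom P V C}
    (h : ∀ v, FOTerm.var v ∈ a.args → u v = w v) : a.applySub u = a.applySub w := by
  simp only [FOAtom.applySub, FOAtom.mk.injEq, true_and, List.map_inj_left]
  exact fun t ht => FOTerm.applySub_congr fun v hv => h v (hv ▸ ht)

/-- If two atoms have the same image under `σ`, then they have the same image under every
substitution that identifies all their terms identified by `σ`. -/
theorem FOAtom.applySub_eq_of_applySub_eq {σ u : FOSubst V C} {a b : FOAtom P V C}
    (hab : a.applySub σ = b.applySub σ)
    (h : ∀ s ∈ a.args, ∀ t ∈ b.args, s.applySub σ = t.applySub σ →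
      s.applySub u = t.applySub u) : a.applySub u = b.applySub u := by
  obtain ⟨p, l⟩ := a
  obtain ⟨p', l'⟩ := b
  simp only [FOAtom.applySub, FOAtom.mk.injEq] at hab h ⊢
  refine ⟨hab.1, ?_⟩
  have hf : List.Forall₂ (fun s t => s.applySub σ = t.applySub σ) l l' := by
    have := List.forall₂_eq_eq_eq.symm ▸ hab.2
    rwa [List.forall₂_map_left_iff, List.forall₂_map_right_iff] at this
  clear hab
  induction hf with
  | nil => rfl
  | cons hst _ ih =>
    simp only [List.map_cons, List.cons.injEq]
    exact ⟨h _ (by simp) _ (by simp) hst,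
      ih fun s hs t ht => h s (by simp [hs]) t (by simp [ht])⟩

theorem IsHom.mono {h : FOSubst V C} {S T T' : Finset (FOAtom P V C)}
    (hh : IsHom h S T) (hT : T ⊆ T') : IsHom h S T' :=
  fun a ha => hT (hh a ha)

theorem IsHom.congr [DecidableEq V] {h h' : FOSubst V C} {S T : Finset (FOAtom P V C)}
    (hh : IsHom h S T) (heq : ∀ v ∈ varsFS S, h' v = h v) : IsHom h' S T := by
  intro a ha
  rw [FOAtom.applySub_congr fun v hv => heq v (mem_varsFS.mpr ⟨a, ha, hv⟩)]
  exact hh a ha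

theorem IsHom.apply_mem_termsFS [DecidableEq V] [DecidableEq C] {h : FOSubst V C}
    {S T : Finset (FOAtom P V C)} (hh : IsHom h S T) {v : V} (hv : v ∈ varsFS S) :
    h v ∈ termsFS T := by
  obtain ⟨a, ha, hva⟩ := mem_varsFS.mp hv
  exact mem_termsFS.mpr ⟨_, hh a ha, List.mem_map.mpr ⟨_, hva, rfl⟩⟩

/-! ## Associated substitutions -/

theorem exists_isAssocSub {r : TRel V C} (hr : Equivalence r) (ha : RelAdmissible r) :
    ∃ u : FOSubst V C, IsAssocSub r u := by
  classical
  let s : Setoid (FOTerm V C) := ⟨r, hr⟩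
  let rep : FOTerm V C → FOTerm V C := fun t =>
    if h : ∃ c, r t (FOTerm.const c) then FOTerm.const h.choose
    else (Quotient.mk s t).out
  have rep_rel (t : FOTerm V C) : r t (rep t) := by
    by_cases h : ∃ c, r t (FOTerm.const c)
    · simpa only [rep, dif_pos h] using h.choose_spec
    · simp only [rep, dif_neg h]
      exact hr.symm (Quotient.mk_out (s := s) t)
  have rep_const {t : FOTerm V C} {c : C} (h : r t (FOTerm.const c)) :
      rep t = FOTerm.const c := by
    have h' : ∃ c, r t (FOTerm.const c) := ⟨c, h⟩
    simp only [rep, dif_pos h']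
    rw [ha _ _ (hr.trans (hr.symm h'.choose_spec) h)]
  have rep_congr {t t' : FOTerm V C} (h : r t t') : rep t = rep t' := by
    by_cases hc : ∃ c, r t (FOTerm.const c)
    · obtain ⟨c, hc⟩ := hc
      rw [rep_const hc, rep_const (hr.trans (hr.symm h) hc)]
    · have hc' : ¬ ∃ c, r t' (FOTerm.const c) := fun ⟨c, h'⟩ => hc ⟨c, hr.trans h h'⟩
      simp only [rep, dif_neg hc, dif_neg hc']
      rw [Quotient.sound (s := s) h]
  have apply_eq (t : FOTerm V C) : t.applySub (fun v => rep (FOTerm.var v)) = rep t := by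
    cases t with
    | var v => rfl
    | const c => exact (rep_const (hr.refl _)).symm
  refine ⟨fun v => rep (FOTerm.var v), fun t t' h => ?_, fun t => ?_, fun v c h => rep_const h⟩
  · rw [apply_eq, apply_eq, rep_congr h]
  · rw [apply_eq]
    exact rep_rel t

theorem IsAssocSub.rel_of_applySub_eq {r : TRel V C} {u : FOSubst V C} (hu : IsAssocSub r u)
    (hr : Equivalence r) {s t : FOTerm V C} (h : s.applySub u = t.applySub u) : r s t :=
  hr.trans (hu.2.1 s) (h ▸ hr.symm (hu.2.1 t))

theorem joinRel_of_mem {rs : List (TRel V C)} {r : TRel V C} (hr : r ∈ rs) {s t : FOTerm V C}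
    (h : r s t) : joinRel rs s t :=
  Relation.EqvGen.rel _ _ ⟨r, hr, h⟩

theorem applySub_eq_of_joinRel {rs : List (TRel V C)} {σ : FOSubst V C}
    (hσ : ∀ r ∈ rs, ∀ s t, r s t → s.applySub σ = t.applySub σ) {s t : FOTerm V C}
    (h : joinRel rs s t) : s.applySub σ = t.applySub σ := by
  induction h with
  | rel s t h => obtain ⟨r, hr, h⟩ := h; exact hσ r hr s t h
  | refl => rfl
  | symm _ _ _ ih => exact ih.symm
  | trans _ _ _ _ _ ih ih' => exact ih.trans ih'

/-! ## Soundness -/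

theorem Interp.evalT_applySub (I : Interp P V C) (a : V → I.dom) (u : FOSubst V C)
    (t : FOTerm V C) : I.evalT a (t.applySub u) = I.evalT (fun v => I.evalT a (u v)) t := by
  cases t <;> rfl

theorem Interp.satAtom_applySub (I : Interp P V C) (a : V → I.dom) (u : FOSubst V C)
    (b : FOAtom P V C) :
    I.satAtom a (b.applySub u) ↔ I.satAtom (fun v => I.evalT a (u v)) b := by
  simp [Interp.satAtom, FOAtom.applySub, Function.comp_def, Interp.evalT_applySub]

theorem Interp.satAtom_congr {I : Interp P V C} {a a' : V → I.dom} {b : FOAtom P V C}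
    (h : ∀ v, FOTerm.var v ∈ b.args → a v = a' v) (hb : I.satAtom a b) : I.satAtom a' b := by
  have : b.args.map (I.evalT a') = b.args.map (I.evalT a) := by
    rw [List.map_inj_left]
    rintro (v | c) ht
    · exact (h v ht).symm
    · rfl
  rwa [Interp.satAtom, this]

/-- An atom whose terms are matched by a substitution `u` with those of a satisfied atom is
satisfied, provided that matched terms have the same values. -/
theorem Interp.satAtom_of_applySub_eq {I : Interp P V C} {a b : V → I.dom} {u : FOSubst V C}
    {p q : FOAtom P V C} (hpq : p.applySub u = q.applySub u)
    (h : ∀ s ∈ p.args, ∀ t ∈ q.args, s.applySub u = t.applySub u → I.evalT a s = I.evalT b t)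
    (hp : I.satAtom a p) : I.satAtom b q := by
  obtain ⟨p, l⟩ := p
  obtain ⟨q, l'⟩ := q
  simp only [FOAtom.applySub, FOAtom.mk.injEq, Interp.satAtom] at hpq h hp ⊢
  have hf : List.Forall₂ (fun s t => s.applySub u = t.applySub u) l l' := by
    have := List.forall₂_eq_eq_eq.symm ▸ hpq.2
    rwa [List.forall₂_map_left_iff, List.forall₂_map_right_iff] at this
  have : l.map (I.evalT a) = l'.map (I.evalT b) := by
    clear hpq hp
    induction hf with
    | nil => rfl
    | cons hst _ ih =>
      simp only [List.map_cons, List.cons.injEq]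
      exact ⟨h _ (by simp) _ (by simp) hst,
        ih fun s hs t ht => h s (by simp [hs]) t (by simp [ht])⟩
  rwa [← this, ← hpq.1]

theorem Interp.modelsFB_of_entailsFS [DecidableEq V] {I : Interp P V C}
    {S T : Finset (FOAtom P V C)} (hST : EntailsFS T S) (hT : I.modelsFB T) :
    I.modelsFB S := by
  obtain ⟨h, hh⟩ := hST
  obtain ⟨a, ha⟩ := hT
  exact ⟨_, fun b hb => (I.satAtom_applySub a h b).mp (ha _ (hh b hb))⟩

theorem IsSafeCopy.entailsFS [DecidableEq P] [DecidableEq V] [DecidableEq C]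
    {Q Qc : Finset (FOAtom P V C)} (h : IsSafeCopy Q Qc) : EntailsFS Qc Q := by
  obtain ⟨ρ, -, rfl⟩ := h
  exact ⟨_, fun a ha => Finset.mem_image_of_mem _ ha⟩

/-- If `a` satisfies `Q ∖ Q'` and is compatible with the partition of a piece-unifier of `Q`
with `B → H`, and `a'` agrees with `a` on `B` and satisfies `H`, then `Q` is satisfied. -/
theorem IsPieceUnifier.modelsFB [DecidableEq P] [DecidableEq V] [DecidableEq C]
    {Q B H : Finset (FOAtom P V C)} {m : PieceUnif P V C} (hm : IsPieceUnifier Q B H m)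
    (hdisj : Disjoint (varsFS Q) (varsFS H)) {I : Interp P V C} {a a' : V → I.dom}
    (ha : ∀ s t, m.rel s t → I.evalT a s = I.evalT a t)
    (haQ : I.satFS a (Q \ m.Q')) (haa' : ∀ v ∈ varsFS B, a' v = a v) (ha' : I.satFS a' H) :
    I.modelsFB Q := by
  classical
  obtain ⟨-, hQ', hH', heqv, -, hadm, hex, hunif⟩ := hm
  have not_mem_Q {z : V} (hz : z ∈ varsFS m.H') : z ∉ varsFS Q := fun h =>
    Finset.disjoint_left.mp hdisj h (varsFS_mono hH' hz)
  let E (v : V) (z : V) : Prop :=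
    z ∈ varsFS m.H' \ varsFS B ∧ m.rel (FOTerm.var z) (FOTerm.var v)
  have E_unique {v z z' : V} (h : E v z) (h' : E v z') : z = z' := by
    rcases hex z h.1 _ (heqv.trans h.2 (heqv.symm h'.2)) with h₁ | ⟨w, hw, hwQ, -⟩
    · cases h₁
      rfl
    · cases hw
      exact absurd (varsFS_mono hQ' (var_mem_termsFS.mp hwQ))
        (not_mem_Q (Finset.mem_sdiff.mp h'.1).1)
  let b : V → I.dom := fun v => if h : ∃ z, E v z then a' h.choose else a v
  have b_ex {v z : V} (h : E v z) : b v = a' z := by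
    have h' : ∃ z, E v z := ⟨z, h⟩
    simp only [b, dif_pos h']
    rw [E_unique h'.choose_spec h]
  have b_other {v : V} (h : ¬ ∃ z, E v z) : b v = a v := by
    simp only [b, dif_neg h]
  refine ⟨b, fun q hq => ?_⟩
  by_cases hqQ' : q ∈ m.Q'
  · obtain ⟨u, hu⟩ := exists_isAssocSub heqv hadm
    have hq' : q.applySub u ∈ applySubFS u m.H' := by
      rw [← hunif u hu]
      exact Finset.mem_image_of_mem _ hqQ'
    obtain ⟨p, hp, hpq⟩ := Finset.mem_image.mp hq'
    refine Interp.satAtom_of_applySub_eq hpq (fun s hs t ht hst => ?_) (ha' p (hH' hp))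
    have hrel : m.rel s t := hu.rel_of_applySub_eq heqv hst
    have eval_s (hns : ∀ z, s = FOTerm.var z → z ∈ varsFS B) :
        I.evalT a' s = I.evalT a s := by
      cases s with
      | var z => exact haa' z (hns z rfl)
      | const c => rfl
    have s_ex {z : V} (hz : z ∈ varsFS m.H' \ varsFS B) (hzs : m.rel (FOTerm.var z) s) :
        s = FOTerm.var z := by
      rcases hex z hz s hzs with h | ⟨w, rfl, hwQ, -⟩
      · exact h
      · exact absurd (varsFS_mono hQ' (var_mem_termsFS.mp hwQ))
          (not_mem_Q (mem_varsFS.mpr ⟨p, hp, hs⟩))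
    by_cases hse : ∃ z, s = FOTerm.var z ∧ z ∉ varsFS B
    · obtain ⟨z, rfl, hzB⟩ := hse
      have hz : z ∈ varsFS m.H' \ varsFS B :=
        Finset.mem_sdiff.mpr ⟨mem_varsFS.mpr ⟨p, hp, hs⟩, hzB⟩
      rcases hex z hz t hrel with rfl | ⟨w, rfl, -, -⟩
      · exact (b_ex ⟨hz, hrel⟩).symm
      · exact (b_ex ⟨hz, hrel⟩).symm
    · rw [eval_s fun z hz => by_contra fun hzB => hse ⟨z, hz, hzB⟩, ha s t hrel]
      cases t with
      | const c => rfl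
      | var v =>
        refine (b_other ?_).symm
        rintro ⟨z, hz, hzv⟩
        exact hse ⟨z, s_ex hz (heqv.trans hzv (heqv.symm hrel)), (Finset.mem_sdiff.mp hz).2⟩
  · have hqm : q ∈ Q \ m.Q' := Finset.mem_sdiff.mpr ⟨hq, hqQ'⟩
    refine Interp.satAtom_congr (fun v hv => (b_other ?_).symm) (haQ q hqm)
    rintro ⟨z, hz, hzv⟩
    rcases hex z hz _ hzv with h | ⟨w, hw, -, hwQ⟩
    · cases h
      exact not_mem_Q (Finset.mem_sdiff.mp hz).1 (mem_varsFS.mpr ⟨q, hq, hv⟩)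
    · cases hw
      exact hwQ (mem_varsFS.mpr ⟨q, hqm, hv⟩)

theorem IsDisjPieceUnifier.exists_modelsFB [DecidableEq P] [DecidableEq V] [DecidableEq C]
    {𝒬 : Set (Finset (FOAtom P V C))} {R : DisjRule P V C} {μ : DisjPieceUnif P V C}
    {u : FOSubst V C} (hμ : IsDisjPieceUnifier 𝒬 R μ) (hu : IsAssocSub μ.rel u)
    {I : Interp P V C} (hR : I.satRule R) (hI : I.modelsFB (betaRw R μ u)) :
    ∃ Q ∈ 𝒬, I.modelsFB Q := by
  obtain ⟨hlQ, hlm, hcopy, hdisjR, -, hpu, -⟩ := hμ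
  obtain ⟨a, ha⟩ := hI
  obtain ⟨H, hH, a', haa', ha'⟩ := hR (fun v => I.evalT a (u v)) fun b hb =>
    (I.satAtom_applySub a u b).mp (ha _ (mem_betaRw.mpr (Or.inl ⟨b, hb, rfl⟩)))
  obtain ⟨⟨i, hi⟩, rfl⟩ := List.mem_iff_get.mp hH
  have hiQ : i < μ.Qs.length := hlQ ▸ hi
  have him : i < μ.mus.length := hlm ▸ hi
  obtain ⟨Q, hQ, hQc⟩ := hcopy i hiQ
  refine ⟨Q, hQ, Interp.modelsFB_of_entailsFS hQc.entailsFS ?_⟩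
  refine (hpu i hi hiQ him).modelsFB ?_ (fun s t hst => ?_) (fun q hq => ?_) haa' ha'
  · exact (hdisjR i hiQ).mono_right fun v hv => DisjRule.mem_vars.mpr (Or.inr ⟨_, hH, hv⟩)
  · rw [← I.evalT_applySub, ← I.evalT_applySub]
    congr 1
    exact hu.1 s t (joinRel_of_mem (List.mem_map.mpr ⟨_, List.get_mem _ _, rfl⟩) hst)
  · exact (I.satAtom_applySub a u q).mp
      (ha _ (mem_betaRw.mpr (Or.inr ⟨i, hiQ, him, q, hq, rfl⟩)))

theorem exists_modelsFB_of_mem_Wop [DecidableEq P] [DecidableEq V] [DecidableEq C]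
    {𝒬 : Finset (Finset (FOAtom P V C))} {ℛ : Set (DisjRule P V C)} {I : Interp P V C}
    (hℛ : ∀ R ∈ ℛ, I.satRule R) (i : ℕ) {Q : Finset (FOAtom P V C)} (hQ : Q ∈ Wop 𝒬 ℛ i)
    (hI : I.modelsFB Q) : ∃ Q ∈ (↑𝒬 : Set (Finset (FOAtom P V C))), I.modelsFB Q := by
  induction i generalizing Q with
  | zero => exact ⟨Q, hQ, hI⟩
  | succ i ih =>
    rcases hQ with hQ | ⟨R, hR, μ, u, hμ, hu, rfl⟩
    · exact ih hQ hI
    · obtain ⟨Q', hQ', hI'⟩ := hμ.exists_modelsFB hu (hℛ R hR) hI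
      exact ih hQ' hI'

/-! ## Completeness -/

theorem exists_injective_notMem_finset [Infinite V] (A : Finset V) :
    ∃ ρ : ℕ × V → V, Function.Injective ρ ∧ ∀ x, ρ x ∉ A := by
  have hcard : Cardinal.mk (ℕ × V) = Cardinal.mk (↑((↑A : Set V)ᶜ) : Type) := by
    rw [Cardinal.mk_compl_finset_of_infinite, Cardinal.mk_prod]
    simp
  obtain ⟨e⟩ := Cardinal.eq.mp hcard
  exact ⟨fun x => e x, Subtype.val_injective.comp e.injective, fun x => (e x).2⟩

theorem Wop_mono [DecidableEq P] [DecidableEq V] [DecidableEq C]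
    (𝒬 : Finset (Finset (FOAtom P V C))) (ℛ : Set (DisjRule P V C)) : Monotone (Wop 𝒬 ℛ) :=
  monotone_nat_of_le_succ fun _ => Set.subset_union_left

/-- The piece-unifier of `Q` with a head `H` induced by a substitution `σ`, where `Q'` consists
of the atoms of `Q` that `σ` does not map into `F`. -/
def PieceUnif.ofSubst [DecidableEq P] [DecidableEq V] [DecidableEq C] (σ : FOSubst V C)
    (F Q H : Finset (FOAtom P V C)) : PieceUnif P V C :=
  let Q' := Q.filter fun q => q.applySub σ ∉ F
  let H' := H.filter fun p => p.applySub σ ∈ applySubFS σ Q'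
  { Q' := Q'
    H' := H'
    rel := fun s t => s = t ∨ (s ∈ termsFS Q' ∪ termsFS H' ∧ t ∈ termsFS Q' ∪ termsFS H' ∧
      s.applySub σ = t.applySub σ) }

theorem PieceUnif.applySub_eq_of_ofSubst_rel [DecidableEq P] [DecidableEq V] [DecidableEq C]
    {σ : FOSubst V C} {F Q H : Finset (FOAtom P V C)} {s t : FOTerm V C}
    (h : (PieceUnif.ofSubst σ F Q H).rel s t) : s.applySub σ = t.applySub σ := by
  rcases h with rfl | ⟨-, -, h⟩
  · rfl
  · exact h

theorem PieceUnif.isPieceUnifier_ofSubst [DecidableEq P] [DecidableEq V] [DecidableEq C]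
    {σ : FOSubst V C} {F Q B H : Finset (FOAtom P V C)} (hB : IsHom σ B F)
    (hQ : IsHom σ Q (F ∪ applySubFS σ H)) (hQF : ¬ IsHom σ Q F)
    (hfresh : ∀ z ∈ varsFS H \ varsFS B, ∃ w, σ z = FOTerm.var w ∧ w ∉ varsFS F)
    (hinj : ∀ z ∈ varsFS H \ varsFS B, ∀ z' ∈ varsFS H \ varsFS B, σ z = σ z' → z = z') :
    IsPieceUnifier Q B H (PieceUnif.ofSubst σ F Q H) := by
  set m := PieceUnif.ofSubst σ F Q H
  have memQ' {q : FOAtom P V C} : q ∈ m.Q' ↔ q ∈ Q ∧ q.applySub σ ∉ F :=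
    Finset.mem_filter
  have memH' {p : FOAtom P V C} :
      p ∈ m.H' ↔ p ∈ H ∧ ∃ q ∈ m.Q', q.applySub σ = p.applySub σ :=
    Finset.mem_filter.trans (and_congr_right fun _ => Finset.mem_image)
  have hH' : m.H' ⊆ H := fun p hp => (memH'.mp hp).1
  refine ⟨?_, fun q hq => (memQ'.mp hq).1, hH', ⟨fun t => Or.inl rfl, ?_, ?_⟩, ?_, ?_, ?_, ?_⟩
  · simp only [IsHom, not_forall] at hQF
    obtain ⟨q, hq, hqF⟩ := hQF
    exact ⟨q, memQ'.mpr ⟨hq, hqF⟩⟩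
  · rintro s t (rfl | ⟨hs, ht, hst⟩)
    · exact Or.inl rfl
    · exact Or.inr ⟨ht, hs, hst.symm⟩
  · rintro s t r (rfl | ⟨hs, ht, hst⟩) hr
    · exact hr
    · rcases hr with rfl | ⟨-, hr, htr⟩
      · exact Or.inr ⟨hs, ht, hst⟩
      · exact Or.inr ⟨hs, hr, hst.trans htr⟩
  · rintro s t (rfl | ⟨hs, ht, -⟩)
    · exact Or.inl rfl
    · exact Or.inr ⟨hs, ht⟩
  · intro c c' h
    have := PieceUnif.applySub_eq_of_ofSubst_rel h
    simpa [FOTerm.applySub] using this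
  · intro z hz t hzt
    have hzH : z ∈ varsFS H \ varsFS B := Finset.sdiff_subset_sdiff (varsFS_mono hH') le_rfl hz
    obtain ⟨w, hw, hwF⟩ := hfresh z hzH
    rcases hzt with rfl | ⟨-, ht, hzt⟩
    · exact Or.inl rfl
    replace hzt : t.applySub σ = FOTerm.var w := hzt.symm.trans hw
    cases t with
    | const c => simp [FOTerm.applySub] at hzt
    | var v =>
      replace hzt : σ v = FOTerm.var w := hzt
      have not_mem {S : Finset (FOAtom P V C)} (hS : IsHom σ S F) : v ∉ varsFS S := fun hv =>
        hwF (var_mem_termsFS.mp (hzt ▸ hS.apply_mem_termsFS hv))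
      rcases Finset.mem_union.mp ht with ht | ht
      · refine Or.inr ⟨v, rfl, ht, not_mem fun q hq => ?_⟩
        obtain ⟨hq, hq'⟩ := Finset.mem_sdiff.mp hq
        exact by_contra fun h => hq' (memQ'.mpr ⟨hq, h⟩)
      · have hv : v ∈ varsFS H \ varsFS B := Finset.mem_sdiff.mpr
          ⟨varsFS_mono hH' (var_mem_termsFS.mp ht), not_mem hB⟩
        exact Or.inl (congrArg _ (hinj v hv z hzH (hzt.trans hw.symm)))
  · intro u hu
    have unify {q p : FOAtom P V C} (hq : q ∈ m.Q') (hp : p ∈ m.H')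
        (hqp : q.applySub σ = p.applySub σ) : q.applySub u = p.applySub u :=
      FOAtom.applySub_eq_of_applySub_eq hqp fun s hs t ht hst => hu.1 s t
        (Or.inr ⟨Finset.mem_union_left _ (mem_termsFS.mpr ⟨q, hq, hs⟩),
          Finset.mem_union_right _ (mem_termsFS.mpr ⟨p, hp, ht⟩), hst⟩)
    ext b
    simp only [applySubFS, Finset.mem_image]
    constructor
    · rintro ⟨q, hq, rfl⟩
      obtain ⟨hqQ, hqF⟩ := memQ'.mp hq
      obtain ⟨p, hp, hpq⟩ :=
        Finset.mem_image.mp ((Finset.mem_union.mp (hQ q hqQ)).resolve_left hqF)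
      have hp' : p ∈ m.H' := memH'.mpr ⟨hp, q, hq, hpq.symm⟩
      exact ⟨p, hp', (unify hq hp' hpq.symm).symm⟩
    · rintro ⟨p, hp, rfl⟩
      obtain ⟨-, q, hq, hqp⟩ := memH'.mp hp
      exact ⟨q, hq, unify hq hp hqp⟩

/-- A substitution that maps pairwise disjoint copies `Qs i` of queries of `𝒬` into the results
of applying a rule to `F`, but not into `F` itself, maps some one-step rewriting into `F`. -/
theorem exists_betaRw_isHom [DecidableEq P] [DecidableEq V] [DecidableEq C]
    {𝒬 : Set (Finset (FOAtom P V C))} {R : DisjRule P V C} {σ : FOSubst V C}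
    {F : Finset (FOAtom P V C)} (hB : IsHom σ R.body F)
    (hfresh : ∀ z ∈ R.vars \ varsFS R.body, ∃ w, σ z = FOTerm.var w ∧ w ∉ varsFS F)
    (hinj : ∀ z ∈ R.vars \ varsFS R.body, ∀ z' ∈ R.vars \ varsFS R.body, σ z = σ z' → z = z')
    (Qs : Fin R.heads.length → Finset (FOAtom P V C))
    (hcopy : ∀ i, ∃ Q ∈ 𝒬, IsSafeCopy Q (Qs i))
    (hdisjR : ∀ i, Disjoint (varsFS (Qs i)) R.vars)
    (hdisj : ∀ i j, i ≠ j → Disjoint (varsFS (Qs i)) (varsFS (Qs j)))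
    (hQ : ∀ i, IsHom σ (Qs i) (F ∪ applySubFS σ (R.heads.get i)))
    (hQF : ∀ i, ¬ IsHom σ (Qs i) F) :
    ∃ (μ : DisjPieceUnif P V C) (u : FOSubst V C), IsDisjPieceUnifier 𝒬 R μ ∧
      IsAssocSub μ.rel u ∧ IsHom σ (betaRw R μ u) F := by
  let m (i : Fin R.heads.length) := PieceUnif.ofSubst σ F (Qs i) (R.heads.get i)
  let μ : DisjPieceUnif P V C := ⟨List.ofFn Qs, List.ofFn m⟩
  have hlQ : μ.Qs.length = R.heads.length := List.length_ofFn
  have hlm : μ.mus.length = R.heads.length := List.length_ofFn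
  have getQ (i : ℕ) (hi : i < μ.Qs.length) : μ.Qs.get ⟨i, hi⟩ = Qs ⟨i, hlQ ▸ hi⟩ := by
    simp [μ]
  have getm (i : ℕ) (hi : i < μ.mus.length) : μ.mus.get ⟨i, hi⟩ = m ⟨i, hlm ▸ hi⟩ := by
    simp [μ]
  have hrel {s t : FOTerm V C} (h : μ.rel s t) : s.applySub σ = t.applySub σ := by
    refine applySub_eq_of_joinRel (fun r hr s t hst => ?_) h
    obtain ⟨_, hm, rfl⟩ := List.mem_map.mp hr
    obtain ⟨i, rfl⟩ := (List.mem_ofFn' _ _).mp hm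
    exact PieceUnif.applySub_eq_of_ofSubst_rel hst
  have hadm : RelAdmissible μ.rel := fun c c' h => by
    simpa [FOTerm.applySub] using hrel h
  have hsub (i : Fin R.heads.length) :
      varsFS (R.heads.get i) \ varsFS R.body ⊆ R.vars \ varsFS R.body :=
    Finset.sdiff_subset_sdiff
      (fun v hv => DisjRule.mem_vars.mpr (Or.inr ⟨_, List.get_mem _ _, hv⟩)) le_rfl
  obtain ⟨u, hu⟩ := exists_isAssocSub (Relation.EqvGen.is_equivalence _) hadm
  refine ⟨μ, u, ⟨hlQ, hlm, fun i hi => ?_, fun i hi => ?_, fun i j hi hj hij => ?_,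
    fun i hi hi1 hi2 => ?_, hadm⟩, hu, fun b hb => ?_⟩
  · rw [getQ]
    exact hcopy _
  · rw [getQ]
    exact hdisjR _
  · rw [getQ, getQ]
    exact hdisj _ _ (by simpa using hij)
  · rw [getQ, getm]
    exact PieceUnif.isPieceUnifier_ofSubst hB (hQ _) (hQF _)
      (fun z hz => hfresh z (hsub _ hz))
      (fun z hz z' hz' => hinj z (hsub _ hz) z' (hsub _ hz'))
  · have absorb (q : FOAtom P V C) : (q.applySub u).applySub σ = q.applySub σ := by
      rw [FOAtom.applySub_applySub]
      exact FOAtom.applySub_congr fun v _ => (hrel (hu.2.1 (FOTerm.var v))).symm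
    rcases mem_betaRw.mp hb with ⟨a, ha, rfl⟩ | ⟨i, h₁, h₂, q, hq, rfl⟩
    · rw [absorb]
      exact hB a ha
    · rw [absorb]
      rw [getQ, getm, Finset.mem_sdiff] at hq
      exact by_contra fun h => hq.2 (Finset.mem_filter.mpr ⟨hq.1, h⟩)

/-- No query of the rewriting `W(𝒬, ℛ)` is entailed by `F`. -/
def WFree [DecidableEq P] [DecidableEq V] [DecidableEq C]
    (𝒬 : Finset (Finset (FOAtom P V C))) (ℛ : Set (DisjRule P V C))
    (F : Finset (FOAtom P V C)) : Prop :=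
  ∀ i, ∀ Q ∈ Wop 𝒬 ℛ i, ¬ EntailsFS F Q

/-- `F` satisfies the trigger `(R, h)`. -/
def SatTrigger [DecidableEq V] (F : Finset (FOAtom P V C)) (R : DisjRule P V C)
    (h : FOSubst V C) : Prop :=
  ∃ H ∈ R.heads, ∃ h' : FOSubst V C, (∀ v ∈ varsFS R.body, h' v = h v) ∧ IsHom h' H F

theorem SatTrigger.mono [DecidableEq V] {F F' : Finset (FOAtom P V C)} {R : DisjRule P V C}
    {h : FOSubst V C} (hF : SatTrigger F R h) (hFF' : F ⊆ F') : SatTrigger F' R h := by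
  obtain ⟨H, hH, h', hh', hH'⟩ := hF
  exact ⟨H, hH, h', hh', hH'.mono hFF'⟩

theorem WFree.exists_satTrigger [DecidableEq P] [DecidableEq V] [DecidableEq C] [Infinite V]
    {𝒬 : Finset (Finset (FOAtom P V C))} {ℛ : Set (DisjRule P V C)}
    {F : Finset (FOAtom P V C)} (hF : WFree 𝒬 ℛ F) {R : DisjRule P V C} (hR : R ∈ ℛ)
    {h : FOSubst V C} (hh : IsTrigger R h F) :
    ∃ F', F ⊆ F' ∧ WFree 𝒬 ℛ F' ∧ SatTrigger F' R h := by
  classical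
  obtain ⟨ρ, hρ, hρA⟩ := exists_injective_notMem_finset (varsFS F ∪ R.vars)
  let h' : FOSubst V C := fun v => if v ∈ varsFS R.body then h v else FOTerm.var (ρ (0, v))
  have h'_body {v : V} (hv : v ∈ varsFS R.body) : h' v = h v := if_pos hv
  have h'_ex {v : V} (hv : v ∉ varsFS R.body) : h' v = FOTerm.var (ρ (0, v)) := if_neg hv
  by_contra hcon
  have hent (i : Fin R.heads.length) :
      ∃ k, ∃ Q ∈ Wop 𝒬 ℛ k, EntailsFS (F ∪ applySubFS h' (R.heads.get i)) Q := by
    by_contra hi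
    refine hcon ⟨_, Finset.subset_union_left,
      fun k Q hQ hE => hi ⟨k, Q, hQ, hE⟩, R.heads.get i, List.get_mem _ _, h',
      fun v hv => h'_body hv,
      fun a ha => Finset.mem_union_right _ (Finset.mem_image_of_mem _ ha)⟩
  choose k Q hQ g hg using hent
  let N := Finset.univ.sup k
  have hQN (i : Fin R.heads.length) : Q i ∈ Wop 𝒬 ℛ N :=
    Wop_mono 𝒬 ℛ (Finset.le_sup (Finset.mem_univ i)) (hQ i)
  let σ : FOSubst V C := fun v =>
    if v ∈ R.vars then h' v
    else if hv : ∃ x : Fin R.heads.length × V, ρ (x.1, x.2) = v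
      then g hv.choose.1 hv.choose.2
      else FOTerm.var v
  have σ_rule {v : V} (hv : v ∈ R.vars) : σ v = h' v := if_pos hv
  have ρ_not_mem (x : ℕ × V) : ρ x ∉ R.vars := fun hx =>
    hρA x (Finset.mem_union_right _ hx)
  have σ_copy (i : Fin R.heads.length) (v : V) : σ (ρ (i, v)) = g i v := by
    have hv : ∃ x : Fin R.heads.length × V, ρ (x.1, x.2) = ρ (i, v) := ⟨(i, v), rfl⟩
    have hx : hv.choose = (i, v) := by
      have := hρ hv.choose_spec
      rw [Prod.mk.injEq] at this
      exact Prod.ext (Fin.ext this.1) this.2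
    simp only [σ, if_neg (ρ_not_mem _), dif_pos hv]
    rw [hx]
  let Qs (i : Fin R.heads.length) : Finset (FOAtom P V C) :=
    (Q i).image (FOAtom.applySub fun v => FOTerm.var (ρ (i, v)))
  have vars_Qs {i : Fin R.heads.length} {w : V} (hw : w ∈ varsFS (Qs i)) :
      ∃ v, w = ρ (i, v) := by
    obtain ⟨_, ha, hwa⟩ := mem_varsFS.mp hw
    obtain ⟨a, -, rfl⟩ := Finset.mem_image.mp ha
    obtain ⟨t, -, ht⟩ := List.mem_map.mp hwa
    cases t with
    | var v =>
      cases ht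
      exact ⟨v, rfl⟩
    | const c => cases ht
  have σ_Qs (i : Fin R.heads.length) (a : FOAtom P V C) :
      (a.applySub fun v => FOTerm.var (ρ (i, v))).applySub σ = a.applySub (g i) := by
    rw [FOAtom.applySub_applySub]
    exact FOAtom.applySub_congr fun v _ => σ_copy i v
  have σ_head (i : Fin R.heads.length) :
      applySubFS σ (R.heads.get i) = applySubFS h' (R.heads.get i) := by
    refine Finset.image_congr fun a ha => FOAtom.applySub_congr fun v hv => σ_rule ?_
    exact DisjRule.mem_vars.mpr
      (Or.inr ⟨_, List.get_mem _ _, mem_varsFS.mpr ⟨a, ha, hv⟩⟩)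
  have σ_ex {z : V} (hz : z ∈ R.vars \ varsFS R.body) : σ z = FOTerm.var (ρ (0, z)) := by
    rw [σ_rule (Finset.mem_sdiff.mp hz).1, h'_ex (Finset.mem_sdiff.mp hz).2]
  obtain ⟨μ, u, hμ, hu, hhom⟩ := exists_betaRw_isHom (𝒬 := Wop 𝒬 ℛ N) (R := R) (σ := σ) (F := F)
    (hh.congr fun v hv => by
      rw [σ_rule (DisjRule.mem_vars.mpr (Or.inl hv)), h'_body hv])
    (fun z hz => ⟨_, σ_ex hz, fun hw => hρA _ (Finset.mem_union_left _ hw)⟩)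
    (fun z hz z' hz' hzz' => by
      rw [σ_ex hz, σ_ex hz', FOTerm.var.injEq] at hzz'
      exact (Prod.mk.inj (hρ hzz')).2)
    Qs
    (fun i => ⟨Q i, hQN i, fun v => ρ (i, v), fun v v' hvv' => (Prod.mk.inj (hρ hvv')).2, rfl⟩)
    (fun i => Finset.disjoint_left.mpr fun w hw hwR => by
      obtain ⟨v, rfl⟩ := vars_Qs hw
      exact ρ_not_mem _ hwR)
    (fun i j hij => Finset.disjoint_left.mpr fun w hw hw' => by
      obtain ⟨v, rfl⟩ := vars_Qs hw
      obtain ⟨v', hv'⟩ := vars_Qs hw'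
      exact hij (Fin.ext (Prod.mk.inj (hρ hv')).1))
    (fun i b hb => by
      obtain ⟨a, ha, rfl⟩ := Finset.mem_image.mp hb
      rw [σ_Qs, σ_head]
      exact hg i a ha)
    (fun i hi => hF (k i) (Q i) (hQ i) ⟨g i, fun a ha => by
      rw [← σ_Qs]
      exact hi _ (Finset.mem_image_of_mem _ ha)⟩)
  exact hF (N + 1) _ (Or.inr ⟨R, hR, μ, u, hμ, hu, rfl⟩) ⟨σ, hhom⟩

theorem WFree.exists_satTrigger_of_finite [DecidableEq P] [DecidableEq V] [DecidableEq C]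
    [Infinite V] {𝒬 : Finset (Finset (FOAtom P V C))} {ℛ : Set (DisjRule P V C)}
    {F : Finset (FOAtom P V C)} (hF : WFree 𝒬 ℛ F)
    {T : Set (DisjRule P V C × FOSubst V C)} (hT : T.Finite) :
    ∃ F', F ⊆ F' ∧ WFree 𝒬 ℛ F' ∧
      ∀ p ∈ T, p.1 ∈ ℛ → IsTrigger p.1 p.2 F → SatTrigger F' p.1 p.2 := by
  induction T, hT using Set.Finite.induction_on with
  | empty => exact ⟨F, subset_rfl, hF, by simp⟩
  | @insert p T _ _ ih =>
    obtain ⟨F₁, hFF₁, hF₁, hsat₁⟩ := ih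
    by_cases hp : p.1 ∈ ℛ ∧ IsTrigger p.1 p.2 F
    · obtain ⟨F₂, hF₁₂, hF₂, hsat₂⟩ := hF₁.exists_satTrigger hp.1 (hp.2.mono hFF₁)
      refine ⟨F₂, hFF₁.trans hF₁₂, hF₂, ?_⟩
      rintro q (rfl | hq) hq₁ hq₂
      · exact hsat₂
      · exact (hsat₁ q hq hq₁ hq₂).mono hF₁₂
    · refine ⟨F₁, hFF₁, hF₁, ?_⟩
      rintro q (rfl | hq) hq₁ hq₂
      · exact absurd ⟨hq₁, hq₂⟩ hp
      · exact hsat₁ q hq hq₁ hq₂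

/-- A breadth-first chase step that preserves `WFree`. -/
theorem WFree.exists_chase_step [DecidableEq P] [DecidableEq V] [DecidableEq C] [Infinite V]
    {𝒬 : Finset (Finset (FOAtom P V C))} {ℛ : Set (DisjRule P V C)} (hfin : ℛ.Finite)
    {F : Finset (FOAtom P V C)} (hF : WFree 𝒬 ℛ F) :
    ∃ F', F ⊆ F' ∧ WFree 𝒬 ℛ F' ∧ ∀ R ∈ ℛ, ∀ h, IsTrigger R h F → SatTrigger F' R h := by
  classical
  have : Finite ℛ := hfin
  let f : (Σ R : ℛ, (↥(varsFS R.1.body) → ↥(termsFS F))) → DisjRule P V C × FOSubst V C :=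
    fun p => (p.1.1, fun v => if hv : v ∈ varsFS p.1.1.body then (p.2 ⟨v, hv⟩).1
      else FOTerm.var v)
  obtain ⟨F', hFF', hF', hsat⟩ := hF.exists_satTrigger_of_finite (Set.finite_range f)
  refine ⟨F', hFF', hF', fun R hR h hh => ?_⟩
  let p : Σ R : ℛ, (↥(varsFS R.1.body) → ↥(termsFS F)) :=
    ⟨⟨R, hR⟩, fun v => ⟨h v.1, IsHom.apply_mem_termsFS hh v.2⟩⟩
  have hp {v : V} (hv : v ∈ varsFS R.body) : (f p).2 v = h v := dif_pos hv
  obtain ⟨H, hH, h', hh', hHF'⟩ :=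
    hsat (f p) ⟨p, rfl⟩ hR (IsHom.congr hh fun v hv => hp hv)
  exact ⟨H, hH, h', fun v hv => (hh' v hv).trans (hp hv), hHF'⟩

theorem exists_mem_of_monotone {α : Type*} {S : ℕ → Finset α} (hS : Monotone S)
    {β : Type*} (B : Finset β) (f : β → α) (hB : ∀ b ∈ B, ∃ n, f b ∈ S n) :
    ∃ n, ∀ b ∈ B, f b ∈ S n := by
  choose! n hn using hB
  exact ⟨B.sup n, fun b hb => hS (Finset.le_sup hb) (hn b hb)⟩

/-- The interpretation on terms whose true atoms are those of the fact bases `S n`. -/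
def Interp.ofChase [Infinite V] (S : ℕ → Finset (FOAtom P V C)) : Interp P V C where
  dom := FOTerm V C
  nonempty := ⟨FOTerm.var (Classical.arbitrary V)⟩
  rel p l := ∃ n, (⟨p, l⟩ : FOAtom P V C) ∈ S n
  cst := FOTerm.const

theorem Interp.satAtom_ofChase [Infinite V] (S : ℕ → Finset (FOAtom P V C))
    (a : FOSubst V C) (b : FOAtom P V C) :
    (Interp.ofChase S).satAtom a b ↔ ∃ n, b.applySub a ∈ S n := by
  have : (Interp.ofChase S).evalT a = FOTerm.applySub a := by
    funext t
    cases t <;> rfl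
  change (∃ n, (⟨b.pred, b.args.map ((Interp.ofChase S).evalT a)⟩ : FOAtom P V C) ∈ S n) ↔ _
  rw [this]
  rfl

theorem Interp.exists_isHom_of_satFS_ofChase [Infinite V] {S : ℕ → Finset (FOAtom P V C)}
    (hS : Monotone S) {a : FOSubst V C} {B : Finset (FOAtom P V C)}
    (h : (Interp.ofChase S).satFS a B) : ∃ n, IsHom a B (S n) :=
  exists_mem_of_monotone hS B (FOAtom.applySub a) fun b hb =>
    (Interp.satAtom_ofChase S a b).mp (h b hb)

theorem WFree.not_semEntails [DecidableEq P] [DecidableEq V] [DecidableEq C] [Infinite V]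
    {𝒬 : Finset (Finset (FOAtom P V C))} {ℛ : Set (DisjRule P V C)} (hfin : ℛ.Finite)
    {F : Finset (FOAtom P V C)} (hF : WFree 𝒬 ℛ F) :
    ¬ SemEntails F ℛ (↑𝒬 : Set (Finset (FOAtom P V C))) := by
  choose! next hsub hfree hsat using
    fun (F : Finset (FOAtom P V C)) (hF : WFree 𝒬 ℛ F) => hF.exists_chase_step hfin
  let S : ℕ → Finset (FOAtom P V C) := fun n => next^[n] F
  have S_succ (n : ℕ) : S (n + 1) = next (S n) := Function.iterate_succ_apply' next n F
  have S_free (n : ℕ) : WFree 𝒬 ℛ (S n) := by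
    induction n with
    | zero => exact hF
    | succ n ih => exact S_succ n ▸ hfree _ ih
  have S_mono : Monotone S := monotone_nat_of_le_succ fun n => by
    rw [S_succ]
    exact hsub _ (S_free n)
  intro hent
  obtain ⟨Q, hQ, a, ha⟩ := hent (Interp.ofChase S)
    ⟨FOTerm.var, fun b hb => (Interp.satAtom_ofChase S _ b).mpr ⟨0, by
      have hid : FOTerm.applySub (FOTerm.var : FOSubst V C) = id := by
        funext t
        cases t <;> rfl
      simpa [FOAtom.applySub, hid, S] using hb⟩⟩
    (fun R hR a ha => by
      obtain ⟨n, hn⟩ := Interp.exists_isHom_of_satFS_ofChase S_mono ha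
      obtain ⟨H, hH, a', haa', ha'⟩ := hsat _ (S_free n) R hR a hn
      rw [← S_succ] at ha'
      exact ⟨H, hH, a', haa', fun b hb =>
        (Interp.satAtom_ofChase S a' b).mpr ⟨n + 1, ha' b hb⟩⟩)
  obtain ⟨n, hn⟩ := Interp.exists_isHom_of_satFS_ofChase S_mono ha
  exact S_free n 0 Q hQ ⟨a, hn⟩

/-- `W(𝒬, ℛ) = ⋃ᵢ Wᵢ(𝒬, ℛ)` is a sound and complete rewriting of
`(𝒬, ℛ)`: for every fact base `F`, `F ⊨ W(𝒬, ℛ)` iff `F, ℛ ⊨ 𝒬`. -/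
theorem stmt9 {P V C : Type} [DecidableEq P] [DecidableEq V] [DecidableEq C] [Infinite V]
    (𝒬 : Finset (Finset (FOAtom P V C))) (ℛ : Set (DisjRule P V C))
    (hfin : ℛ.Finite) (hWF : ∀ R ∈ ℛ, R.WF) (F : Finset (FOAtom P V C)) :
    (∃ Q ∈ ⋃ i : ℕ, Wop 𝒬 ℛ i, EntailsFS F Q) ↔
      SemEntails F ℛ (↑𝒬 : Set (Finset (FOAtom P V C))) := by
  constructor
  · rintro ⟨Q, hQ, hFQ⟩ I hI hℛ
    obtain ⟨i, hi⟩ := Set.mem_iUnion.mp hQ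
    exact exists_modelsFB_of_mem_Wop hℛ i hi (Interp.modelsFB_of_entailsFS hFQ hI)
  · intro hent
    by_contra hcon
    have hF : WFree 𝒬 ℛ F := fun i Q hQ hFQ => hcon ⟨Q, Set.mem_iUnion.mpr ⟨i, hQ⟩, hFQ⟩
    exact hF.not_semEntails hfin hent
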